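/- Let T ∈ (0, ∞], and let u : ℝ × ℝ → ℝ be smooth, spatially periodic, and satisfy the μBurgers equation u_txx + 3u_x u_xx + u u_xxx = 0 for all (t,x) with 0 ≤ t < T. Assume the initial datum u(0,·) is not constant. Then M := min over x ∈ [0,1] of u_x(0,x) is strictly negative, and T ≤ −1/M. In particular, smooth spatially periodic solutions of the μBurgers equation with nonconstant initial data break down in finite time: the supremum norm of u_x(t,·) cannot remain bounded up to and beyond time −1/M. -/

import Mathlib

open intervalIntegral

/-- Partial derivative in the second (spatial) variable. -/
noncomputable def pdx (u : ℝ × ℝ → ℝ) : ℝ × ℝ → ℝ := fun p => deriv (fun y => u (p.1, y)) p.2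

/-- Partial derivative in the first (time) variable. -/
noncomputable def pdt (u : ℝ × ℝ → ℝ) : ℝ × ℝ → ℝ := fun p => deriv (fun s => u (s, p.2)) p.1

open scoped ContDiff

theorem hasDerivAt_pdx {f : ℝ × ℝ → ℝ} (hf : ContDiff ℝ ∞ f) (t x : ℝ) :
    HasDerivAt (fun y => f (t, y)) (pdx f (t, x)) x := by
  have hd : Differentiable ℝ f := hf.differentiable (by simp)
  have : DifferentiableAt ℝ (fun y => f (t, y)) x := by fun_prop
  exact this.hasDerivAt

theorem pdx_eq_fderiv {f : ℝ × ℝ → ℝ} (hf : ContDiff ℝ ∞ f) :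
    pdx f = fun p => fderiv ℝ f p (0, 1) := by
  funext ⟨t, x⟩
  have hd := (hf.differentiable (by simp) (t, x)).hasFDerivAt
  exact (hasDerivAt_pdx hf t x).unique
    (hd.comp_hasDerivAt x ((hasDerivAt_const x t).prodMk (hasDerivAt_id x)))

theorem pdt_eq_fderiv {f : ℝ × ℝ → ℝ} (hf : ContDiff ℝ ∞ f) :
    pdt f = fun p => fderiv ℝ f p (1, 0) := by
  funext ⟨t, x⟩
  have hd := (hf.differentiable (by simp) (t, x)).hasFDerivAt
  exact (hd.comp_hasDerivAt t ((hasDerivAt_id t).prodMk (hasDerivAt_const t x))).deriv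

theorem ContDiff.pdx {f : ℝ × ℝ → ℝ} (hf : ContDiff ℝ ∞ f) : ContDiff ℝ ∞ (pdx f) := by
  rw [pdx_eq_fderiv hf]
  exact (hf.fderiv_right (by simp)).clm_apply contDiff_const

theorem ContDiff.pdt {f : ℝ × ℝ → ℝ} (hf : ContDiff ℝ ∞ f) : ContDiff ℝ ∞ (pdt f) := by
  rw [pdt_eq_fderiv hf]
  exact (hf.fderiv_right (by simp)).clm_apply contDiff_const

theorem pdt_pdx_comm {f : ℝ × ℝ → ℝ} (hf : ContDiff ℝ ∞ f) : pdt (pdx f) = pdx (pdt f) := by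
  rw [pdt_eq_fderiv hf.pdx, pdx_eq_fderiv hf.pdt, pdx_eq_fderiv hf, pdt_eq_fderiv hf]
  funext p
  have hd : DifferentiableAt ℝ (fderiv ℝ f) p :=
    (hf.fderiv_right (m := ∞) (by simp)).differentiable (by simp) p
  have hs : IsSymmSndFDerivAt ℝ f p := hf.contDiffAt.isSymmSndFDerivAt
    (by rw [minSmoothness_of_isRCLikeNormedField]; exact WithTop.coe_le_coe.2 le_top)
  rw [fderiv_clm_apply hd (differentiableAt_const _),
    fderiv_clm_apply hd (differentiableAt_const _)]
  simpa using hs (1, 0) (0, 1)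

/-- Chain rule along a curve `t ↦ (t, q t)`. -/
theorem hasDerivAt_along {f : ℝ × ℝ → ℝ} (hf : ContDiff ℝ ∞ f) {q : ℝ → ℝ} {q' t : ℝ}
    (hq : HasDerivAt q q' t) :
    HasDerivAt (fun s => f (s, q s)) (pdt f (t, q t) + q' * pdx f (t, q t)) t := by
  have hd := (hf.differentiable (by simp) (t, q t)).hasFDerivAt
  refine HasDerivAt.congr_deriv (hd.comp_hasDerivAt t ((hasDerivAt_id t).prodMk hq)) ?_
  rw [pdt_eq_fderiv hf, pdx_eq_fderiv hf]
  have : ((1 : ℝ), q') = (1, 0) + q' • (0, 1) := by simp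
  rw [this, map_add, map_smul, smul_eq_mul]

/-- A solution of a homogeneous linear equation that starts at zero stays zero. -/
theorem eq_zero_of_hasDerivAt_neg_mul {a v : ℝ → ℝ} (ha : Continuous a) {τ : ℝ}
    (hv : ∀ t ∈ Set.Icc 0 τ, HasDerivAt v (-a t * v t) t) (h0 : v 0 = 0) :
    ∀ t ∈ Set.Icc 0 τ, v t = 0 := by
  have hd : ∀ t ∈ Set.Icc 0 τ,
      HasDerivAt (fun s => v s * Real.exp (∫ r in (0 : ℝ)..s, a r)) 0 t := by
    intro t ht
    refine HasDerivAt.congr_deriv ((hv t ht).mul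
      (ha.integral_hasStrictDerivAt 0 t).hasDerivAt.exp) ?_
    ring
  intro t ht
  have h := constant_of_has_deriv_right_zero
    (fun s hs => (hd s hs).continuousAt.continuousWithinAt)
    (fun s hs => (hd s (Set.Ico_subset_Icc_self hs)).hasDerivWithinAt) t ht
  simpa [h0, (Real.exp_pos _).ne'] using h

theorem pdx_add_one {f : ℝ × ℝ → ℝ} (hper : ∀ t x, f (t, x + 1) = f (t, x)) (t x : ℝ) :
    pdx f (t, x + 1) = pdx f (t, x) := by
  simp only [pdx]
  rw [← deriv_comp_add_const (fun y => f (t, y)) 1 x]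
  simp only [hper]

theorem pdt_add_one {f : ℝ × ℝ → ℝ} (hper : ∀ t x, f (t, x + 1) = f (t, x)) (t x : ℝ) :
    pdt f (t, x + 1) = pdt f (t, x) := by
  simp only [pdt, hper]

/-- A periodic function with vanishing second derivative has vanishing first derivative. -/
theorem deriv_eq_zero_of_periodic {g g' : ℝ → ℝ} (hper : ∀ x, g (x + 1) = g x)
    (hg : ∀ x, HasDerivAt g (g' x) x) (hg' : ∀ x, HasDerivAt g' 0 x) (x : ℝ) : g' x = 0 := by
  obtain ⟨c, -, hc⟩ := exists_hasDerivAt_eq_zero (f := g) (f' := g') (zero_lt_one' ℝ)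
    (fun x _ => (hg x).continuousAt.continuousWithinAt) (by simpa using (hper 0).symm)
    (fun x _ => hg x)
  rw [← hc]
  exact is_const_of_deriv_eq_zero (fun x => (hg' x).differentiableAt) (fun x => (hg' x).deriv) x c

/-- A periodic function with nonnegative derivative is constant. -/
theorem eq_of_periodic_of_deriv_nonneg {g g' : ℝ → ℝ} (hper : Function.Periodic g 1)
    (hg : ∀ x, HasDerivAt g (g' x) x) (hpos : ∀ x, 0 ≤ g' x) (x y : ℝ) : g x = g y := by
  have hm : Monotone g := monotone_of_hasDerivAt_nonneg hg hpos
  have key : ∀ x y, g x ≤ g y := by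
    intro x y
    obtain ⟨n, hn⟩ := exists_nat_ge (x - y)
    calc g x ≤ g (y + n * 1) := hm (by linarith)
      _ = g y := hper.nat_mul n y
  exact le_antisymm (key x y) (key y x)

/-- The quantity `u_t + u u_x` does not depend on `x` along periodic solutions of the
μBurgers equation. -/
theorem muBurgers_first_integral {u : ℝ × ℝ → ℝ} (hu : ContDiff ℝ ∞ u)
    (hper : ∀ t x, u (t, x + 1) = u (t, x)) {t : ℝ}
    (heq : ∀ x, pdx (pdx (pdt u)) (t, x) + 3 * pdx u (t, x) * pdx (pdx u) (t, x)
        + u (t, x) * pdx (pdx (pdx u)) (t, x) = 0) :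
    (∀ x, pdx (pdt u) (t, x) + pdx u (t, x) ^ 2 + u (t, x) * pdx (pdx u) (t, x) = 0) ∧
      ∀ x, pdt u (t, x) + u (t, x) * pdx u (t, x) = pdt u (t, 0) + u (t, 0) * pdx u (t, 0) := by
  have hg : ∀ x, HasDerivAt (fun y => pdt u (t, y) + u (t, y) * pdx u (t, y))
      (pdx (pdt u) (t, x) + pdx u (t, x) ^ 2 + u (t, x) * pdx (pdx u) (t, x)) x := fun x => by
    refine HasDerivAt.congr_deriv ((hasDerivAt_pdx hu.pdt t x).add
      ((hasDerivAt_pdx hu t x).mul (hasDerivAt_pdx hu.pdx t x))) ?_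
    ring
  have hg' : ∀ x, HasDerivAt
      (fun y => pdx (pdt u) (t, y) + pdx u (t, y) ^ 2 + u (t, y) * pdx (pdx u) (t, y)) 0 x :=
    fun x => by
      refine HasDerivAt.congr_deriv
        (((hasDerivAt_pdx hu.pdt.pdx t x).add ((hasDerivAt_pdx hu.pdx t x).pow 2)).add
        ((hasDerivAt_pdx hu t x).mul (hasDerivAt_pdx hu.pdx.pdx t x))) ?_
      rw [← heq x]
      ring
  have h0 := deriv_eq_zero_of_periodic
    (fun x => by simp only [pdt_add_one hper, pdx_add_one hper, hper]) hg hg'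
  exact ⟨h0, fun x => is_const_of_deriv_eq_zero (fun x => (hg x).differentiableAt)
    (fun x => (hg x).deriv.trans (h0 x)) x 0⟩

/-- Along the characteristic starting at `x₀`, the slope of a periodic solution of the
μBurgers equation solves the Riccati equation `w' = -w ^ 2`. -/
theorem muBurgers_slope_along_characteristic {u : ℝ × ℝ → ℝ} (hu : ContDiff ℝ ∞ u)
    (hper : ∀ t x, u (t, x + 1) = u (t, x)) {τ : ℝ}
    (heq : ∀ t ∈ Set.Icc 0 τ, ∀ x,
      pdx (pdx (pdt u)) (t, x) + 3 * pdx u (t, x) * pdx (pdx u) (t, x)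
        + u (t, x) * pdx (pdx (pdx u)) (t, x) = 0) (x₀ : ℝ) :
    ∀ t ∈ Set.Icc 0 τ, ∃ w, w * (1 + pdx u (0, x₀) * t) = pdx u (0, x₀) := by
  have hcu := hu.continuous
  have hcx := hu.pdx.continuous
  have hct := hu.pdt.continuous
  set c : ℝ → ℝ := fun t => pdt u (t, 0) + u (t, 0) * pdx u (t, 0) with hc
  have hcc : Continuous c := by fun_prop
  set p : ℝ → ℝ := fun t => u (0, x₀) + ∫ s in (0 : ℝ)..t, c s with hp
  have hp' : ∀ t, HasDerivAt p (c t) t := fun t =>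
    (hcc.integral_hasStrictDerivAt 0 t).hasDerivAt.const_add _
  have hpc : Continuous p := continuous_iff_continuousAt.2 fun t => (hp' t).continuousAt
  set q : ℝ → ℝ := fun t => x₀ + ∫ s in (0 : ℝ)..t, p s with hq
  have hq' : ∀ t, HasDerivAt q (p t) t := fun t =>
    (hpc.integral_hasStrictDerivAt 0 t).hasDerivAt.const_add _
  have hqc : Continuous q := continuous_iff_continuousAt.2 fun t => (hq' t).continuousAt
  have hac : Continuous fun t => pdx u (t, q t) := by fun_prop
  have hup : ∀ t ∈ Set.Icc 0 τ, u (t, q t) - p t = 0 := by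
    refine eq_zero_of_hasDerivAt_neg_mul hac (fun t ht => ?_) (by simp [hp, hq])
    refine HasDerivAt.congr_deriv ((hasDerivAt_along hu (hq' t)).sub (hp' t)) ?_
    have h : _ = c t := (muBurgers_first_integral hu hper (heq t ht)).2 (q t)
    rw [← h]
    ring
  have hw : ∀ t ∈ Set.Icc 0 τ,
      pdx u (t, q t) * (1 + pdx u (0, x₀) * t) - pdx u (0, x₀) = 0 := by
    refine eq_zero_of_hasDerivAt_neg_mul hac (fun t ht => ?_) (by simp [hq])
    refine HasDerivAt.congr_deriv (((hasDerivAt_along hu.pdx (hq' t)).mul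
      (((hasDerivAt_id t).const_mul (pdx u (0, x₀))).const_add 1)).sub_const
      (pdx u (0, x₀))) ?_
    have h := (muBurgers_first_integral hu hper (heq t ht)).1 (q t)
    rw [sub_eq_zero.1 (hup t ht)] at h
    rw [pdt_pdx_comm hu]
    simp only [id]
    linear_combination (1 + pdx u (0, x₀) * t) * h
  exact fun t ht => ⟨_, sub_eq_zero.1 (hw t ht)⟩

/-- smooth spatially periodic solutions of the μBurgers equation with
nonconstant initial data break down in finite time: with
`M = min_{x ∈ [0,1]} u_x(0,x)` one has `M < 0` and the lifespan `T` satisfies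
`T ≤ −1/M`. -/
theorem muBurgers_blowup
    (T : EReal) (hT : 0 < T)
    (u : ℝ × ℝ → ℝ) (hu : ContDiff ℝ (⊤ : ℕ∞) u)
    (hper : ∀ t x, u (t, x + 1) = u (t, x))
    (heq : ∀ t x : ℝ, 0 ≤ t → (t : EReal) < T →
      pdx (pdx (pdt u)) (t, x) + 3 * pdx u (t, x) * pdx (pdx u) (t, x)
        + u (t, x) * pdx (pdx (pdx u)) (t, x) = 0)
    (hnc : ∃ x y : ℝ, u (0, x) ≠ u (0, y)) :
    sInf ((fun x => pdx u (0, x)) '' Set.Icc (0:ℝ) 1) < 0 ∧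
      T ≤ ((-1 / sInf ((fun x => pdx u (0, x)) '' Set.Icc (0:ℝ) 1) : ℝ) : EReal) := by
  have hdx := hasDerivAt_pdx hu 0
  have hcx : Continuous fun x => pdx u (0, x) := hu.pdx.continuous.comp (by fun_prop)
  obtain ⟨x₀, -, hx₀, hmin⟩ := isCompact_Icc.exists_sInf_image_eq_and_le
    (Set.nonempty_Icc.2 (zero_le_one' ℝ)) hcx.continuousOn
  rw [hx₀]
  have hM : pdx u (0, x₀) < 0 := by
    by_contra! hM
    obtain ⟨x, y, hxy⟩ := hnc
    refine hxy (eq_of_periodic_of_deriv_nonneg (fun x => hper 0 x) hdx (fun x => ?_) x y)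
    have hpx : Function.Periodic (fun x => pdx u (0, x)) 1 := pdx_add_one hper 0
    obtain ⟨z, hz, hxz⟩ := hpx.exists_mem_Ico₀ one_pos x
    exact hxz ▸ hM.trans (hmin z (Set.Ico_subset_Icc_self hz))
  refine ⟨hM, ?_⟩
  by_contra! hlt
  have hτ : 0 ≤ -1 / pdx u (0, x₀) := div_nonneg_of_nonpos (by norm_num) hM.le
  obtain ⟨w, hw⟩ := muBurgers_slope_along_characteristic hu hper
    (fun t ht x => heq t x ht.1 ((EReal.coe_le_coe_iff.2 ht.2).trans_lt hlt)) x₀ _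
    (Set.right_mem_Icc.2 hτ)
  rw [mul_div_cancel₀ _ hM.ne] at hw
  norm_num at hw
  exact hM.ne hw.symm
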